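/- arXiv:1303.0854 — 2 statements merged into one kernel-verified Lean document; each statement's English description precedes it below -/
import Mathlib

section
/- For all a, b, c, d ≥ 1 and all n ≥ b + d, the polynomials Q_{n,132}^{(a,b,c,d)}(x) satisfy the recurrence Q_{n,132}^{(a,b,c,d)}(x) = Σ_{i=1}^{b-1} C_{i-1} · Q_{n-i,132}^{(a,b-i,c,d)}(x) + Σ_{i=b}^{n-d} Q_{i-1,132}^{(a-1,b,c,0)}(x) · Q_{n-i,132}^{(a,0,c,d)}(x) + Σ_{i=n-d+1}^{n} Q_{i-1,132}^{(a-1,b,c,d-(n-i))}(x) · C_{n-i}. -/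
open Finset Polynomial

/-- `σ i` matches the quadrant marked mesh pattern `MMP(a,b,c,d)` in `σ`:
there are at least `a` indices `j > i` with `σ j > σ i`, at least `b` indices
`j < i` with `σ j > σ i`, at least `c` indices `j < i` with `σ j < σ i`, and
at least `d` indices `j > i` with `σ j < σ i`. -/
def MatchesMMP {n : ℕ} (a b c d : ℕ) (σ : Equiv.Perm (Fin n)) (i : Fin n) : Prop :=
  a ≤ (Finset.univ.filter (fun j => i < j ∧ σ i < σ j)).card ∧
  b ≤ (Finset.univ.filter (fun j => j < i ∧ σ i < σ j)).card ∧
  c ≤ (Finset.univ.filter (fun j => j < i ∧ σ j < σ i)).card ∧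
  d ≤ (Finset.univ.filter (fun j => i < j ∧ σ j < σ i)).card

instance {n : ℕ} (a b c d : ℕ) (σ : Equiv.Perm (Fin n)) :
    DecidablePred (MatchesMMP a b c d σ) := fun i => by
  unfold MatchesMMP; infer_instance

/-- `mmp a b c d σ` is the number of indices `i` such that `σ i` matches
`MMP(a,b,c,d)` in `σ`. -/
def mmp {n : ℕ} (a b c d : ℕ) (σ : Equiv.Perm (Fin n)) : ℕ :=
  (Finset.univ.filter (MatchesMMP a b c d σ)).card

/-- `σ` avoids the classical pattern 132. -/
def Avoids132 {n : ℕ} (σ : Equiv.Perm (Fin n)) : Prop :=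
  ¬ ∃ i j k : Fin n, i < j ∧ j < k ∧ σ i < σ k ∧ σ k < σ j

instance {n : ℕ} : DecidablePred (Avoids132 (n := n)) := fun σ => by
  unfold Avoids132; infer_instance

/-- The set `S_n(132)` of 132-avoiding permutations of `{1,…,n}`. -/
def Av132 (n : ℕ) : Finset (Equiv.Perm (Fin n)) :=
  Finset.univ.filter Avoids132

/-- `Q n a b c d = Σ_{σ ∈ S_n(132)} x^{mmp^{(a,b,c,d)}(σ)}`, a polynomial in `ℤ[x]`. -/
noncomputable def Q (n a b c d : ℕ) : Polynomial ℤ :=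
  ∑ σ ∈ Av132 n, Polynomial.X ^ (mmp a b c d σ)

section helpers

variable {p k m : ℕ}

def posL (h : p + (k + 1) = m) (q : Fin p) : Fin m := ⟨q, by omega⟩
def posM (h : p + (k + 1) = m) : Fin m := ⟨p, by omega⟩
def posR (h : p + (k + 1) = m) (r : Fin k) : Fin m := ⟨p + 1 + r, by omega⟩
def valL (h : p + (k + 1) = m) (q : Fin p) : Fin m := ⟨q + k, by omega⟩
def valM (h : p + (k + 1) = m) : Fin m := ⟨p + k, by omega⟩
def valR (h : p + (k + 1) = m) (r : Fin k) : Fin m := ⟨r, by omega⟩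

theorem pos_cases (h : p + (k + 1) = m) (i : Fin m) :
    (∃ q, i = posL h q) ∨ i = posM h ∨ ∃ r, i = posR h r := by
  rcases lt_trichotomy i.1 p with hi | hi | hi
  · exact Or.inl ⟨⟨i, hi⟩, rfl⟩
  · exact Or.inr (Or.inl (Fin.ext hi))
  · exact Or.inr (Or.inr ⟨⟨i - (p + 1), by omega⟩, Fin.ext (by simp [posR]; omega)⟩)

theorem card_split (h : p + (k + 1) = m) (P : Fin m → Prop) [DecidablePred P] :
    (univ.filter P).card = (univ.filter (fun q => P (posL h q))).card
      + (if P (posM h) then 1 else 0) + (univ.filter (fun r => P (posR h r))).card := by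
  subst h
  simp only [Finset.card_filter]
  rw [Fin.sum_univ_add, Fin.sum_univ_succ, ← add_assoc]
  congr 1
  refine Finset.sum_congr rfl fun r _ => ?_
  have : Fin.natAdd p r.succ = posR rfl r := Fin.ext (by simp [posR]; omega)
  rw [this]

def glueFun (h : p + (k + 1) = m) (τ : Equiv.Perm (Fin p)) (ρ : Equiv.Perm (Fin k))
    (i : Fin m) : Fin m :=
  if hi : i.1 < p then valL h (τ ⟨i, hi⟩)
  else if hi' : i.1 = p then valM h
  else valR h (ρ ⟨i - (p + 1), by omega⟩)

variable (h : p + (k + 1) = m) (τ : Equiv.Perm (Fin p)) (ρ : Equiv.Perm (Fin k))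

theorem glueFun_L (q : Fin p) : glueFun h τ ρ (posL h q) = valL h (τ q) := by
  simp [glueFun, posL]

theorem glueFun_M : glueFun h τ ρ (posM h) = valM h := by
  simp [glueFun, posM]

theorem glueFun_R (r : Fin k) : glueFun h τ ρ (posR h r) = valR h (ρ r) := by
  have h1 : ¬ (p + 1 + r.1 < p) := by omega
  have h2 : ¬ (p + 1 + r.1 = p) := by omega
  simp [glueFun, posR, h1, h2]

theorem glueFun_inj : Function.Injective (glueFun h τ ρ) := by
  intro i j hij
  rcases pos_cases h i with ⟨q, rfl⟩ | rfl | ⟨r, rfl⟩ <;>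
  rcases pos_cases h j with ⟨q', rfl⟩ | rfl | ⟨r', rfl⟩ <;>
  simp only [glueFun_L, glueFun_M, glueFun_R, valL, valM, valR, Fin.mk.injEq] at hij
  · have : τ q = τ q' := Fin.ext (by omega)
    rw [τ.injective this]
  · have := (τ q).2; omega
  · omega
  · have := (τ q').2; omega
  · rfl
  · omega
  · omega
  · omega
  · have : ρ r = ρ r' := Fin.ext hij
    rw [ρ.injective this]

noncomputable def glue : Equiv.Perm (Fin m) :=
  Equiv.ofBijective (glueFun h τ ρ) (Finite.injective_iff_bijective.mp (glueFun_inj h τ ρ))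

theorem glue_L (q : Fin p) : glue h τ ρ (posL h q) = valL h (τ q) := glueFun_L h τ ρ q
theorem glue_M : glue h τ ρ (posM h) = valM h := glueFun_M h τ ρ
theorem glue_R (r : Fin k) : glue h τ ρ (posR h r) = valR h (ρ r) := glueFun_R h τ ρ r

@[simp] theorem pLL (q q' : Fin p) : posL h q < posL h q' ↔ q < q' := Iff.rfl
@[simp] theorem pLM (q : Fin p) : posL h q < posM h ↔ True := by simp [posL, posM]
@[simp] theorem pML (q : Fin p) : posM h < posL h q ↔ False := by simp [posL, posM]
@[simp] theorem pLR (q : Fin p) (r : Fin k) : posL h q < posR h r ↔ True := by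
  simp [posL, posR]; omega
@[simp] theorem pRL (q : Fin p) (r : Fin k) : posR h r < posL h q ↔ False := by
  simp [posL, posR]; omega
@[simp] theorem pMR (r : Fin k) : posM h < posR h r ↔ True := by
  simp [posM, posR]; omega
@[simp] theorem pRM (r : Fin k) : posR h r < posM h ↔ False := by
  simp [posM, posR]; omega
@[simp] theorem pRR (r r' : Fin k) : posR h r < posR h r' ↔ r < r' := by
  simp [posR]
@[simp] theorem vLL (q q' : Fin p) : valL h q < valL h q' ↔ q < q' := by simp [valL]
@[simp] theorem vLM (q : Fin p) : valL h q < valM h ↔ True := by simp [valL, valM]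
@[simp] theorem vML (q : Fin p) : valM h < valL h q ↔ False := by
  simp [valL, valM]
@[simp] theorem vLR (q : Fin p) (r : Fin k) : valL h q < valR h r ↔ False := by
  simp [valL, valR]; omega
@[simp] theorem vRL (q : Fin p) (r : Fin k) : valR h r < valL h q ↔ True := by
  simp [valL, valR]; omega
@[simp] theorem vRM (r : Fin k) : valR h r < valM h ↔ True := by
  simp [valM, valR]; omega
@[simp] theorem vMR (r : Fin k) : valM h < valR h r ↔ False := by
  simp [valM, valR]; omega
@[simp] theorem vRR (r r' : Fin k) : valR h r < valR h r' ↔ r < r' := Iff.rfl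

theorem match_L (a b c d : ℕ) (q : Fin p) :
    MatchesMMP a b c d (glue h τ ρ) (posL h q) ↔ MatchesMMP (a - 1) b c (d - k) τ q := by
  unfold MatchesMMP
  simp only [card_split h, glue_L, glue_M, glue_R]
  simp

theorem match_M (a b c d : ℕ) (ha : 1 ≤ a) :
    ¬ MatchesMMP a b c d (glue h τ ρ) (posM h) := by
  unfold MatchesMMP
  simp only [card_split h, glue_L, glue_M, glue_R]
  simp
  omega

theorem match_R (a b c d : ℕ) (r : Fin k) :
    MatchesMMP a b c d (glue h τ ρ) (posR h r) ↔ MatchesMMP a (b - (p + 1)) c d ρ r := by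
  unfold MatchesMMP
  simp only [card_split h, glue_L, glue_M, glue_R]
  simp
  intros
  omega

theorem mmp_glue (a b c d : ℕ) (ha : 1 ≤ a) :
    mmp a b c d (glue h τ ρ) = mmp (a - 1) b c (d - k) τ + mmp a (b - (p + 1)) c d ρ := by
  unfold mmp
  rw [card_split h]
  simp only [match_L, match_R, match_M h τ ρ a b c d ha]
  simp

theorem avoids_glue : Avoids132 (glue h τ ρ) ↔ Avoids132 τ ∧ Avoids132 ρ := by
  constructor
  · intro H
    constructor
    · rintro ⟨i, j, l, h1, h2, h3, h4⟩
      exact H ⟨posL h i, posL h j, posL h l, by simpa [glue_L] using ⟨h1, h2, h3, h4⟩⟩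
    · rintro ⟨i, j, l, h1, h2, h3, h4⟩
      exact H ⟨posR h i, posR h j, posR h l, by simpa [glue_R] using ⟨h1, h2, h3, h4⟩⟩
  · rintro ⟨H1, H2⟩ ⟨i, j, l, h1, h2, h3, h4⟩
    rcases pos_cases h i with ⟨q, rfl⟩ | rfl | ⟨r, rfl⟩ <;>
    rcases pos_cases h j with ⟨q', rfl⟩ | rfl | ⟨r', rfl⟩ <;>
    rcases pos_cases h l with ⟨q'', rfl⟩ | rfl | ⟨r'', rfl⟩ <;>
    simp [glue_L, glue_R, glue_M] at h1 h2 h3 h4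
    · exact H1 ⟨_, _, _, h1, h2, h3, h4⟩
    · exact H2 ⟨_, _, _, h1, h2, h3, h4⟩

theorem glue_inj2 (τ' : Equiv.Perm (Fin p)) (ρ' : Equiv.Perm (Fin k))
    (e : glue h τ ρ = glue h τ' ρ') : τ = τ' ∧ ρ = ρ' := by
  constructor
  · ext q
    have := congrArg (fun f => f (posL h q)) e
    simp only [glue_L, valL, Fin.mk.injEq] at this
    omega
  · ext r
    have := congrArg (fun f => f (posR h r)) e
    simpa only [glue_R, valR, Fin.mk.injEq] using this

theorem glue_surj (σ : Equiv.Perm (Fin m)) (hσ : Avoids132 σ) (hM : σ (posM h) = valM h) :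
    ∃ τ ρ, glue (p := p) (k := k) h τ ρ = σ := by
  have lt (q : Fin p) (r : Fin k) : σ (posR h r) < σ (posL h q) := by
    by_contra hc
    have hne : σ (posL h q) ≠ σ (posR h r) := by
      intro e
      have := σ.injective e
      simp [posL, posR] at this
      omega
    have h1 : σ (posL h q) < σ (posR h r) := lt_of_le_of_ne (not_lt.mp hc) hne
    refine hσ ⟨posL h q, posM h, posR h r, by simp, by simp, h1, ?_⟩
    have hne' : σ (posR h r) ≠ σ (posM h) := by
      intro e
      have := σ.injective e
      simp [posM, posR] at this
      omega
    refine lt_of_le_of_ne ?_ hne'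
    rw [hM, Fin.le_def]
    simp only [valM]
    omega
  have hR (r : Fin k) : (σ (posR h r)).1 < k := by
    have hlt : ∀ x ∈ (univ.image (fun q => σ (posL h q)) ∪ {σ (posM h)}),
        x ∈ Finset.Ioi (σ (posR h r)) := by
      intro x hx
      simp only [mem_union, mem_image, mem_univ, true_and, mem_singleton] at hx
      rw [Finset.mem_Ioi]
      rcases hx with ⟨q, rfl⟩ | rfl
      · exact lt q r
      · have hne' : σ (posR h r) ≠ σ (posM h) := by
          intro e
          have := σ.injective e
          simp [posM, posR] at this
          omega
        refine lt_of_le_of_ne ?_ hne'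
        rw [hM, Fin.le_def]
        simp only [valM]
        omega
    have := Finset.card_le_card hlt
    rw [Finset.card_union_of_disjoint, Finset.card_image_of_injective, Fin.card_Ioi] at this
    · simp at this; omega
    · intro x y hxy
      have := σ.injective hxy
      simpa [posL, Fin.ext_iff] using this
    · simp [posL, posM]
      intro x
      omega
  have hL (q : Fin p) : k ≤ (σ (posL h q)).1 := by
    have hlt : ∀ x ∈ (univ.image (fun r => σ (posR h r))),
        x ∈ Finset.Iio (σ (posL h q)) := by
      intro x hx
      simp only [mem_image, mem_univ, true_and] at hx
      rw [Finset.mem_Iio]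
      rcases hx with ⟨r, rfl⟩
      exact lt q r
    have := Finset.card_le_card hlt
    rw [Finset.card_image_of_injective, Fin.card_Iio] at this
    · simpa using this
    · intro x y hxy
      have := σ.injective hxy
      simpa [posR, Fin.ext_iff] using this
  have hL' (q : Fin p) : (σ (posL h q)).1 < p + k := by
    have hne' : σ (posL h q) ≠ σ (posM h) := by
      intro e
      have := σ.injective e
      simp [posM, posL] at this
      omega
    rw [hM] at hne'
    have : (σ (posL h q)).1 ≠ p + k := fun e => hne' (Fin.ext e)
    omega
  let t : Fin p → Fin p := fun q => ⟨(σ (posL h q)).1 - k, by have := hL' q; have := hL q; omega⟩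
  let s : Fin k → Fin k := fun r => ⟨(σ (posR h r)).1, hR r⟩
  have ht : Function.Injective t := by
    intro x y hxy
    simp only [t, Fin.mk.injEq] at hxy
    have h1 := hL x
    have h2 := hL y
    have := σ.injective (Fin.ext (by omega) : σ (posL h x) = σ (posL h y))
    simpa [posL, Fin.ext_iff] using this
  have hs : Function.Injective s := by
    intro x y hxy
    simp only [s, Fin.mk.injEq] at hxy
    have := σ.injective (Fin.ext hxy)
    simpa [posR, Fin.ext_iff] using this
  refine ⟨Equiv.ofBijective t (Finite.injective_iff_bijective.mp ht),
    Equiv.ofBijective s (Finite.injective_iff_bijective.mp hs), ?_⟩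
  ext i
  rcases pos_cases h i with ⟨q, rfl⟩ | rfl | ⟨r, rfl⟩
  · rw [glue_L]
    have := hL q
    simp [valL, t]
    omega
  · rw [glue_M, hM]
  · rw [glue_R]
    simp [valR, s]

theorem sum_fiber {M : Type*} [AddCommMonoid M] (F : Equiv.Perm (Fin m) → M) :
    ∑ σ ∈ (Av132 m).filter (fun σ => σ (posM h) = valM h), F σ =
      ∑ x ∈ Av132 p ×ˢ Av132 k, F (glue h x.1 x.2) := by
  symm
  refine Finset.sum_bij (fun x _ => glue h x.1 x.2) ?_ ?_ ?_ ?_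
  · rintro ⟨τ, ρ⟩ hx
    simp only [Av132, mem_product, mem_filter, mem_univ, true_and] at hx ⊢
    exact ⟨(avoids_glue h τ ρ).mpr hx, glue_M h τ ρ⟩
  · rintro ⟨τ, ρ⟩ _ ⟨τ', ρ'⟩ _ e
    obtain ⟨rfl, rfl⟩ := glue_inj2 h τ ρ τ' ρ' e
    rfl
  · intro σ hσ
    simp only [Av132, mem_filter, mem_univ, true_and] at hσ
    obtain ⟨τ, ρ, e⟩ := glue_surj h σ hσ.1 hσ.2
    refine ⟨(τ, ρ), ?_, e⟩
    have h1 := hσ.1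
    rw [← e, avoids_glue] at h1
    simpa [Av132] using h1
  · intros; rfl

end helpers

theorem sum_Av132_succ {M : Type*} [AddCommMonoid M] (n : ℕ)
    (F : Equiv.Perm (Fin (n + 1)) → M) :
    ∑ σ ∈ Av132 (n + 1), F σ = ∑ i : Fin (n + 1), ∑ x ∈ Av132 i.1 ×ˢ Av132 (n - i.1),
      F (glue (m := n + 1) (by omega) x.1 x.2) := by
  rw [← Finset.sum_fiberwise (Av132 (n + 1)) (fun σ => σ.symm (Fin.last n)) F]
  refine Finset.sum_congr rfl fun i _ => ?_
  rw [← sum_fiber]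
  refine Finset.sum_congr (Finset.filter_congr fun σ _ => ?_) fun _ _ => rfl
  rw [Equiv.symm_apply_eq, eq_comm]
  have h1 : posM (p := i.1) (k := n - i.1) (m := n + 1) (by omega) = i := rfl
  have h2 : valM (p := i.1) (k := n - i.1) (m := n + 1) (by omega) = Fin.last n :=
    Fin.ext (by simp [valM]; omega)
  rw [h1, h2]

theorem card_Av132 (n : ℕ) : (Av132 n).card = catalan n := by
  induction n using Nat.strong_induction_on with
  | _ n ih =>
    cases n with
    | zero => rw [catalan_zero]; decide
    | succ n =>
      rw [catalan_succ, Finset.card_eq_sum_ones, sum_Av132_succ]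
      refine Finset.sum_congr rfl fun i _ => ?_
      rw [← Finset.card_eq_sum_ones, Finset.card_product, ih _ (by omega), ih _ (by omega)]

theorem Q_succ (n a b c d : ℕ) (ha : 1 ≤ a) :
    Q (n + 1) a b c d = ∑ i ∈ Finset.range (n + 1),
      Q i (a - 1) b c (d - (n - i)) * Q (n - i) a (b - (i + 1)) c d := by
  rw [Finset.sum_range]
  unfold Q
  rw [sum_Av132_succ]
  refine Finset.sum_congr rfl fun i _ => ?_
  rw [Finset.sum_mul_sum, ← Finset.sum_product']
  refine Finset.sum_congr rfl fun x _ => ?_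
  rw [mmp_glue _ _ _ _ _ _ _ ha, pow_add]

theorem Q_eq_catalan (n a b c d : ℕ) (H : n ≤ b ∨ n ≤ d) :
    Q n a b c d = (catalan n : Polynomial ℤ) := by
  have : ∀ σ ∈ Av132 n, (X : Polynomial ℤ) ^ mmp a b c d σ = 1 := by
    intro σ _
    have : mmp a b c d σ = 0 := by
      unfold mmp
      rw [Finset.card_eq_zero, Finset.filter_eq_empty_iff]
      intro i _ hm
      obtain ⟨-, h2, -, h4⟩ := hm
      have k2 := Finset.card_le_card (show univ.filter (fun j => j < i ∧ σ i < σ j) ⊆ univ.erase i by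
        intro j hj
        simp at hj ⊢
        exact hj.1.ne)
      have k4 := Finset.card_le_card (show univ.filter (fun j => i < j ∧ σ j < σ i) ⊆ univ.erase i by
        intro j hj
        simp at hj ⊢
        exact hj.1.ne')
      rw [Finset.card_erase_of_mem (mem_univ i), Finset.card_univ, Fintype.card_fin] at k2 k4
      have := i.2
      omega
    rw [this, pow_zero]
  unfold Q
  rw [Finset.sum_congr rfl this, Finset.sum_const, card_Av132]
  simp

/-- the recurrence for `Q_{n,132}^{(a,b,c,d)}(x)` for `a,b,c,d ≥ 1`, `n ≥ b+d`. -/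
theorem stmt18 (a b c d n : ℕ) (ha : 1 ≤ a) (hb : 1 ≤ b) (hc : 1 ≤ c) (hd : 1 ≤ d)
    (hn : b + d ≤ n) :
    Q n a b c d =
      (∑ i ∈ Finset.Icc 1 (b - 1),
        (catalan (i - 1) : Polynomial ℤ) * Q (n - i) a (b - i) c d) +
      (∑ i ∈ Finset.Icc b (n - d), Q (i - 1) (a - 1) b c 0 * Q (n - i) a 0 c d) +
      ∑ i ∈ Finset.Icc (n - d + 1) n,
        Q (i - 1) (a - 1) b c (d - (n - i)) * (catalan (n - i) : Polynomial ℤ) := by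
  obtain ⟨n, rfl⟩ : ∃ n', n = n' + 1 := ⟨n - 1, by omega⟩
  rw [Q_succ n a b c d ha]
  set G : ℕ → Polynomial ℤ := fun i =>
    Q (i - 1) (a - 1) b c (d - (n + 1 - i)) * Q (n + 1 - i) a (b - i) c d with hG
  have e0 : ∑ i ∈ Finset.range (n + 1),
      Q i (a - 1) b c (d - (n - i)) * Q (n - i) a (b - (i + 1)) c d
      = ∑ i ∈ Finset.Ico 1 (n + 2), G i := by
    rw [Finset.sum_Ico_eq_sum_range]
    refine Finset.sum_congr rfl fun i _ => ?_
    have h1 : 1 + i - 1 = i := by omega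
    have h2 : n + 1 - (1 + i) = n - i := by omega
    have h3 : 1 + i = i + 1 := by omega
    simp only [hG, h1, h2, h3]
    rw [show n + 1 - (i + 1) = n - i by omega, Nat.add_sub_cancel]
  have i1 : Finset.Icc 1 (b - 1) = Finset.Ico 1 b := by ext; simp; omega
  have i2 : Finset.Icc b (n + 1 - d) = Finset.Ico b (n + 2 - d) := by ext; simp; omega
  have i3 : Finset.Icc (n + 1 - d + 1) (n + 1) = Finset.Ico (n + 2 - d) (n + 2) := by
    ext; simp; omega
  rw [e0, i1, i2, i3, ← Finset.sum_Ico_consecutive G (show 1 ≤ n + 2 - d by omega)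
      (show n + 2 - d ≤ n + 2 by omega),
    ← Finset.sum_Ico_consecutive G hb (show b ≤ n + 2 - d by omega)]
  congr 1
  · congr 1
    · refine Finset.sum_congr rfl fun i hi => ?_
      rw [Finset.mem_Ico] at hi
      simp only [hG]
      rw [Q_eq_catalan (i - 1) _ b _ _ (by omega)]
    · refine Finset.sum_congr rfl fun i hi => ?_
      rw [Finset.mem_Ico] at hi
      simp only [hG]
      rw [show d - (n + 1 - i) = 0 by omega, show b - i = 0 by omega]
  · refine Finset.sum_congr rfl fun i hi => ?_
    rw [Finset.mem_Ico] at hi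
    simp only [hG]
    rw [Q_eq_catalan (n + 1 - i) _ _ _ d (by omega)]
end

section
/- For all n ≥ 6, the coefficient of x^{n-5} in the polynomial Q_{n,132}^{(1,1,1,1)}(x) equals 17 + 4·binom(n-3, 2). -/
open Finset Polynomial

section TreeGF

open BinaryTree

/-- Defect statistics on binary trees, one for each of the flags patterns. -/
def dA : BinaryTree Unit → ℕ
  | .nil => 0
  | .node _ L R => dA L + (if L = .nil then 1 else 0) + dA R

def dB : BinaryTree Unit → ℕ
  | .nil => 0
  | .node _ L R => dB L + 1 + dA R

def dE : BinaryTree Unit → ℕ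
  | .nil => 0
  | .node _ L R => (if R = .nil then dE L else dA L) +
      (if L = .nil ∨ R = .nil then 1 else 0) + dE R

def dF : BinaryTree Unit → ℕ
  | .nil => 0
  | .node _ L R => (if R = .nil then dE L else dA L) + 1 + dF R

def dG : BinaryTree Unit → ℕ
  | .nil => 0
  | .node _ L R => (if R = .nil then dG L else dB L) + 1 + dE R

def dH : BinaryTree Unit → ℕ
  | .nil => 0
  | .node _ L R => (if R = .nil then dG L else dB L) + 1 + dF R

/-- Generating function of a weight on trees. -/
noncomputable def gf (w : BinaryTree Unit → ℤ[X]) : PowerSeries ℤ[X] :=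
  PowerSeries.mk fun n => ∑ t ∈ treesOfNumNodesEq n, w t

noncomputable def gfn (f : BinaryTree Unit → BinaryTree Unit → ℤ[X]) : PowerSeries ℤ[X] :=
  PowerSeries.mk fun n => ∑ p ∈ antidiagonal n,
    ∑ L ∈ treesOfNumNodesEq p.1, ∑ R ∈ treesOfNumNodesEq p.2, f L R

noncomputable def dlt (t : BinaryTree Unit) : ℤ[X] := if t = .nil then 1 else 0

lemma gf_eq (w : BinaryTree Unit → ℤ[X]) :
    gf w = PowerSeries.C (w .nil) + PowerSeries.X * gfn (fun L R => w (.node () L R)) := by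
  ext1 n
  cases n with
  | zero => simp [gf]
  | succ n =>
    rw [map_add, PowerSeries.coeff_succ_X_mul, PowerSeries.coeff_C]
    simp only [gf, gfn, PowerSeries.coeff_mk, treesOfNumNodesEq_succ]
    rw [sum_biUnion]
    · simp [sum_product]
      rfl
    · simp_rw [Set.PairwiseDisjoint, Set.Pairwise, disjoint_left]
      aesop

lemma gfn_mul (u v : BinaryTree Unit → ℤ[X]) :
    gfn (fun L R => u L * v R) = gf u * gf v := by
  ext1 n
  simp only [gf, gfn, PowerSeries.coeff_mk, PowerSeries.coeff_mul, sum_mul_sum]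

lemma gfn_add (f g : BinaryTree Unit → BinaryTree Unit → ℤ[X]) :
    gfn (fun L R => f L R + g L R) = gfn f + gfn g := by
  ext1 n
  simp only [gfn, PowerSeries.coeff_mk, map_add, sum_add_distrib]

lemma gf_add (u v : BinaryTree Unit → ℤ[X]) : gf (fun t => u t + v t) = gf u + gf v := by
  ext1 n
  simp only [gf, PowerSeries.coeff_mk, map_add, sum_add_distrib]

lemma gf_sub (u v : BinaryTree Unit → ℤ[X]) : gf (fun t => u t - v t) = gf u - gf v := by
  ext1 n
  simp only [gf, PowerSeries.coeff_mk, map_sub, sum_sub_distrib]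

lemma gf_smul (c : ℤ[X]) (v : BinaryTree Unit → ℤ[X]) :
    gf (fun t => c * v t) = PowerSeries.C c * gf v := by
  ext1 n
  simp only [gf, PowerSeries.coeff_mk, PowerSeries.coeff_C_mul, mul_sum]

lemma gf_dlt : gf dlt = 1 := by
  ext1 n
  simp only [gf, PowerSeries.coeff_mk, PowerSeries.coeff_one, dlt, sum_ite_eq',
    mem_treesOfNumNodesEq]
  simp [eq_comm]

noncomputable def wt (d : BinaryTree Unit → ℕ) (t : BinaryTree Unit) : ℤ[X] := X ^ d t

local notation "yy" => (PowerSeries.C (X : ℤ[X]))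
local notation "tt" => (PowerSeries.X : PowerSeries ℤ[X])

lemma eqA : gf (wt dA) = 1 + tt * ((yy + gf (wt dA) - 1) * gf (wt dA)) := by
  conv_lhs => rw [gf_eq]
  have : (fun L R => wt dA (.node () L R)) =
      fun L R => (X * dlt L + wt dA L - dlt L) * wt dA R := by
    funext L R
    by_cases h : L = .nil
    · subst h; simp [wt, dlt, dA, pow_add]
    · simp [wt, dlt, dA, pow_add, h]
  rw [this, gfn_mul, gf_sub, gf_add, gf_smul, gf_dlt]
  simp [wt, dA]

lemma eqB : gf (wt dB) = 1 + tt * (yy * gf (wt dB) * gf (wt dA)) := by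
  conv_lhs => rw [gf_eq]
  have : (fun L R => wt dB (.node () L R)) =
      fun L R => (X * wt dB L) * wt dA R := by
    funext L R
    simp [wt, dB, pow_add]; ring
  rw [this, gfn_mul, gf_smul]
  simp [wt, dB]

lemma eqE : gf (wt dE) = 1 + tt * (yy * gf (wt dE) +
    (yy + gf (wt dA) - 1) * (gf (wt dE) - 1)) := by
  conv_lhs => rw [gf_eq]
  have : (fun L R => wt dE (.node () L R)) =
      fun L R => (X * wt dE L) * dlt R +
        (X * dlt L + wt dA L - dlt L) * (wt dE R - dlt R) := by
    funext L R
    by_cases h : L = .nil <;> by_cases h' : R = .nil <;>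
    simp [wt, dlt, dE, dA, pow_add, h, h'] <;> ring
  rw [this, gfn_add, gfn_mul, gfn_mul, gf_sub, gf_sub, gf_add, gf_smul, gf_smul, gf_dlt]
  simp [wt, dE]

lemma eqF : gf (wt dF) = 1 + tt * (yy * gf (wt dE) +
    (yy * gf (wt dA)) * (gf (wt dF) - 1)) := by
  conv_lhs => rw [gf_eq]
  have : (fun L R => wt dF (.node () L R)) =
      fun L R => (X * wt dE L) * dlt R +
        (X * wt dA L) * (wt dF R - dlt R) := by
    funext L R
    by_cases h' : R = .nil <;>
    simp [wt, dlt, dF, pow_add, h'] <;> ring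
  rw [this, gfn_add, gfn_mul, gfn_mul, gf_sub, gf_smul, gf_smul, gf_dlt]
  simp [wt, dF]

lemma eqG : gf (wt dG) = 1 + tt * (yy * gf (wt dG) +
    (yy * gf (wt dB)) * (gf (wt dE) - 1)) := by
  conv_lhs => rw [gf_eq]
  have : (fun L R => wt dG (.node () L R)) =
      fun L R => (X * wt dG L) * dlt R +
        (X * wt dB L) * (wt dE R - dlt R) := by
    funext L R
    by_cases h' : R = .nil <;>
    simp [wt, dlt, dG, dE, pow_add, h'] <;> ring
  rw [this, gfn_add, gfn_mul, gfn_mul, gf_sub, gf_smul, gf_smul, gf_dlt]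
  simp [wt, dG]

lemma eqH : gf (wt dH) = 1 + tt * (yy * gf (wt dG) +
    (yy * gf (wt dB)) * (gf (wt dF) - 1)) := by
  conv_lhs => rw [gf_eq]
  have : (fun L R => wt dH (.node () L R)) =
      fun L R => (X * wt dG L) * dlt R +
        (X * wt dB L) * (wt dF R - dlt R) := by
    funext L R
    by_cases h' : R = .nil <;>
    simp [wt, dlt, dH, dF, pow_add, h'] <;> ring
  rw [this, gfn_add, gfn_mul, gfn_mul, gf_sub, gf_smul, gf_smul, gf_dlt]
  simp [wt, dH]

/-- The `y^k`-part of a bivariate series. -/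
noncomputable def cc (k : ℕ) (F : PowerSeries ℤ[X]) : PowerSeries ℤ :=
  PowerSeries.mk fun n => (PowerSeries.coeff n F).coeff k

lemma cc_add (k : ℕ) (F G : PowerSeries ℤ[X]) : cc k (F + G) = cc k F + cc k G := by
  ext n; simp [cc]

lemma cc_sub (k : ℕ) (F G : PowerSeries ℤ[X]) : cc k (F - G) = cc k F - cc k G := by
  ext n; simp [cc]

lemma cc_one_zero : cc 0 1 = 1 := by
  ext n; simp only [cc, PowerSeries.coeff_mk, PowerSeries.coeff_one]; split_ifs <;> simp

lemma cc_one_succ (k : ℕ) : cc (k + 1) 1 = 0 := by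
  ext n
  simp only [cc, PowerSeries.coeff_mk, PowerSeries.coeff_one]; split_ifs <;> simp [Polynomial.coeff_one]

lemma cc_t (k : ℕ) (F : PowerSeries ℤ[X]) : cc k (tt * F) = PowerSeries.X * cc k F := by
  ext n; cases n <;> simp [cc, PowerSeries.coeff_succ_X_mul]

lemma cc_y_zero : cc 0 yy = 0 := by
  ext n; simp only [cc, PowerSeries.coeff_mk, PowerSeries.coeff_C]; split_ifs <;> simp

lemma cc_y_one : cc 1 yy = 1 := by
  ext n; simp only [cc, PowerSeries.coeff_mk, PowerSeries.coeff_C, PowerSeries.coeff_one]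
  split_ifs <;> simp

lemma cc_y_succ (k : ℕ) : cc (k + 2) yy = 0 := by
  ext n; simp only [cc, PowerSeries.coeff_mk, PowerSeries.coeff_C]
  split_ifs <;> simp [Polynomial.coeff_X]

lemma cc_mul (k : ℕ) (F G : PowerSeries ℤ[X]) :
    cc k (F * G) = ∑ p ∈ antidiagonal k, cc p.1 F * cc p.2 G := by
  ext n
  simp only [cc, PowerSeries.coeff_mk, PowerSeries.coeff_mul, Polynomial.finsetSum_coeff,
    Polynomial.coeff_mul, map_sum]
  rw [sum_comm]

lemma cc_y_mul_zero (F : PowerSeries ℤ[X]) : cc 0 (yy * F) = 0 := by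
  rw [cc_mul]; simp [cc_y_zero]

lemma cc_y_mul_succ (k : ℕ) (F : PowerSeries ℤ[X]) : cc (k + 1) (yy * F) = cc k F := by
  ext n; simp [cc, PowerSeries.coeff_C_mul]

lemma H5_eq : (1 - PowerSeries.X) ^ 3 * cc 5 (gf (wt dH)) =
    (38 * PowerSeries.X ^ 5 - 85 * PowerSeries.X ^ 6 + 68 * PowerSeries.X ^ 7
      - 17 * PowerSeries.X ^ 8 : PowerSeries ℤ) := by
  have hA := fun k => congrArg (cc k) eqA
  have hB := fun k => congrArg (cc k) eqB
  have hE := fun k => congrArg (cc k) eqE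
  have hF := fun k => congrArg (cc k) eqF
  have hG := fun k => congrArg (cc k) eqG
  have hH := fun k => congrArg (cc k) eqH
  generalize gf (wt dA) = A at *
  generalize gf (wt dB) = B at *
  generalize gf (wt dE) = E at *
  generalize gf (wt dF) = F at *
  generalize gf (wt dG) = G at *
  generalize gf (wt dH) = H at *
  simp only [cc_add, cc_t, mul_assoc] at hA hB hE hF hG hH
  have z0 : (antidiagonal 0 : Finset (ℕ × ℕ)) = {(0,0)} := rfl
  have z1 : (antidiagonal 1 : Finset (ℕ × ℕ)) = {(0,1),(1,0)} := rfl
  have z2 : (antidiagonal 2 : Finset (ℕ × ℕ)) = {(0,2),(1,1),(2,0)} := rfl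
  have z3 : (antidiagonal 3 : Finset (ℕ × ℕ)) = {(0,3),(1,2),(2,1),(3,0)} := rfl
  have z4 : (antidiagonal 4 : Finset (ℕ × ℕ)) = {(0,4),(1,3),(2,2),(3,1),(4,0)} := rfl
  have o0 := cc_one_zero
  have o1 := cc_one_succ 0
  have o2 := cc_one_succ 1
  have o3 := cc_one_succ 2
  have o4 := cc_one_succ 3
  have o5 := cc_one_succ 4
  have y2 := cc_y_succ 0
  have y3 := cc_y_succ 1
  have y4 := cc_y_succ 2
  norm_num at o1 o2 o3 o4 o5 y2 y3 y4
  have A0 : cc 0 A = 1 := by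
    have h := hA 0
    simp only [cc_mul, z0, sum_singleton, cc_sub, cc_add, cc_y_zero, o0] at h
    have h2 : (cc 0 A - 1) * (1 - PowerSeries.X * cc 0 A) = 0 := by linear_combination h
    rcases mul_eq_zero.1 h2 with h3 | h3
    · exact sub_eq_zero.1 h3
    · have := congrArg (PowerSeries.coeff 0) h3
      simp at this
  have A1 : cc 1 A * (1 - PowerSeries.X) = PowerSeries.X := by
    have h := hA 1
    simp [cc_mul, z1, cc_sub, cc_add, cc_y_zero, cc_y_one, o0, o1, A0] at h
    linear_combination h
  have A2 : cc 2 A * (1 - PowerSeries.X) ^ 3 = PowerSeries.X ^ 2 := by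
    have h := hA 2
    simp [cc_mul, z2, cc_sub, cc_add, cc_y_zero, cc_y_one, o0, o1, o2, y2, A0] at h
    linear_combination (1 - PowerSeries.X) ^ 2 * h + (PowerSeries.X * (1 - PowerSeries.X) + PowerSeries.X * (cc 1 A * (1 - PowerSeries.X) + PowerSeries.X)) * A1
  have B0 : cc 0 B = 1 := by
    have h := hB 0
    simpa [cc_y_mul_zero, o0] using h
  have B1 := hB 1
  have B2 := hB 2
  have B3 := hB 3
  have E0 : cc 0 E = 1 := by
    have h := hE 0
    simp [cc_y_mul_zero, cc_mul, z0, cc_sub, cc_add, cc_y_zero, o0, A0] at h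
    exact h
  have E1 := hE 1
  have E2 := hE 2
  have E3 := hE 3
  have F0 : cc 0 F = 1 := by
    have h := hF 0
    simpa [cc_y_mul_zero, o0] using h
  have F1 := hF 1
  have F2 := hF 2
  have F3 := hF 3
  have F4 := hF 4
  have G0 : cc 0 G = 1 := by
    have h := hG 0
    simpa [cc_y_mul_zero, o0] using h
  have G1 := hG 1
  have G2 := hG 2
  have G3 := hG 3
  have G4 := hG 4
  have H5 := hH 5
  clear hA hB hE hF hG hH
  rw [o1, cc_y_mul_succ] at B1 F1 G1
  rw [o2, cc_y_mul_succ] at B2 F2 G2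
  rw [o3, cc_y_mul_succ] at B3 F3 G3
  rw [o4, cc_y_mul_succ] at F4 G4
  rw [o5, cc_y_mul_succ] at H5
  rw [cc_y_mul_succ] at F1 F2 F3 F4 G1 G2 G3 G4 H5 E1 E2 E3
  simp [cc_mul, z0, z1, z2, z3, z4, cc_sub, cc_add, cc_y_zero, cc_y_one, o0, o1, o2, o3, o4, y2, y3, y4,
    A0, B0, E0, F0, G0] at B1 B2 B3 E1 E2 E3 F1 F2 F3 F4 G1 G2 G3 G4 H5
  have key : cc 5 H = 2 * PowerSeries.X ^ 3 * cc 2 A + 2 * PowerSeries.X ^ 4 * cc 2 A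
      + 9 * PowerSeries.X ^ 4 * cc 1 A + 27 * PowerSeries.X ^ 5 + 12 * PowerSeries.X ^ 5 * cc 1 A
      + 2 * PowerSeries.X ^ 5 * cc 1 A ^ 2 := by
    rw [H5, G4, F4, G3, F3, B3, E3, G2, F2, B2, E2, F1, G1, B1, E1]
    ring
  rw [key]
  generalize cc 1 A = a at *
  generalize cc 2 A = b at *
  generalize (PowerSeries.X : PowerSeries ℤ) = t at *
  linear_combination (2 * t ^ 3 + 2 * t ^ 4) * A2 + ((9 * t ^ 4 + 12 * t ^ 5) * (1 - t) ^ 2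
    + 2 * t ^ 5 * (1 - t) * (a * (1 - t) + t)) * A1

lemma H5_coeff (n : ℕ) (hn : 6 ≤ n) :
    PowerSeries.coeff n (cc 5 (gf (wt dH))) = ((17 + 4 * (n - 3).choose 2 : ℕ) : ℤ) := by
  have h := H5_eq
  generalize cc 5 (gf (wt dH)) = H at *
  have h' : H - 3 * (PowerSeries.X ^ 1 * H) + 3 * (PowerSeries.X ^ 2 * H) - PowerSeries.X ^ 3 * H =
     (38 * PowerSeries.X ^ 5 - 85 * PowerSeries.X ^ 6 + 68 * PowerSeries.X ^ 7
      - 17 * PowerSeries.X ^ 8 : PowerSeries ℤ) := by rw [← h]; ring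
  have e : ∀ m : ℕ, ∀ G : PowerSeries ℤ, ∀ k : ℤ, PowerSeries.coeff m (PowerSeries.C k * G) = k * PowerSeries.coeff m G := by
    intro m G k; exact PowerSeries.coeff_C_mul _ _ _
  have r : ∀ m, _ := fun m => congrArg (PowerSeries.coeff m) h'
  have c3 : (3 : PowerSeries ℤ) = PowerSeries.C 3 := by simp
  have c38 : (38 : PowerSeries ℤ) = PowerSeries.C 38 := by simp
  have c85 : (85 : PowerSeries ℤ) = PowerSeries.C 85 := by simp
  have c68 : (68 : PowerSeries ℤ) = PowerSeries.C 68 := by simp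
  have c17 : (17 : PowerSeries ℤ) = PowerSeries.C 17 := by simp
  simp only [c3, c38, c85, c68, c17, map_sub, map_add, e, PowerSeries.coeff_X_pow_mul',
    PowerSeries.coeff_X_pow] at r
  have r0 := r 0
  have r1 := r 1
  have r2 := r 2
  have r3 := r 3
  have r4 := r 4
  have r5 := r 5
  have r6 := r 6
  have r7 := r 7
  have r8 := r 8
  norm_num at r0 r1 r2 r3 r4 r5 r6 r7 r8
  have main : ∀ m, PowerSeries.coeff (m + 6) H = 17 + 2 * ((m : ℤ) + 3) * (m + 2) ∧
      PowerSeries.coeff (m + 7) H = 17 + 2 * ((m : ℤ) + 4) * (m + 3) ∧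
      PowerSeries.coeff (m + 8) H = 17 + 2 * ((m : ℤ) + 5) * (m + 4) := by
    intro m
    induction m with
    | zero => norm_num; omega
    | succ m ih =>
      have r9 := r (m + 9)
      simp [show m + 9 - 1 = m + 8 by omega, show m + 9 - 2 = m + 7 by omega,
        show m + 9 - 3 = m + 6 by omega, show 3 ≤ m + 9 by omega, show 2 ≤ m + 9 by omega] at r9
      obtain ⟨i1, i2, i3⟩ := ih
      refine ⟨?_, ?_, ?_⟩
      · rw [show m + 1 + 6 = m + 7 by ring, i2]; push_cast; ring
      · rw [show m + 1 + 7 = m + 8 by ring, i3]; push_cast; ring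
      · rw [show m + 1 + 8 = m + 9 by ring]; push_cast
        rw [i1, i2, i3] at r9
        linear_combination r9
  obtain ⟨m, rfl⟩ := Nat.exists_eq_add_of_le' hn
  rw [(main m).1, show m + 6 - 3 = m + 3 by omega]
  have := Nat.triangle_succ (m + 2)
  have h2 : 2 * (m + 3).choose 2 = (m + 3) * (m + 2) := by
    rw [Nat.choose_two_right, Nat.mul_div_cancel' (Nat.even_mul_pred_self (m + 3)).two_dvd]; rfl
  push_cast
  zify at h2
  linear_combination (-2) * h2

lemma gf_coeff (d : BinaryTree Unit → ℕ) (n k : ℕ) :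
    PowerSeries.coeff n (cc k (gf (wt d))) = (#{t ∈ treesOfNumNodesEq n | d t = k} : ℤ) := by
  simp [cc, gf, wt, Polynomial.finsetSum_coeff, Polynomial.coeff_X_pow, eq_comm]

end TreeGF

section Lists

/-- `x` occurs before `y` in the list. -/
def Bef : List ℕ → ℕ → ℕ → Prop
  | [], _, _ => False
  | a :: l, x, y => (x = a ∧ y ∈ l) ∨ Bef l x y

lemma Bef.mem {l : List ℕ} {x y : ℕ} (h : Bef l x y) : x ∈ l ∧ y ∈ l := by
  induction l with
  | nil => exact h.elim
  | cons a l ih =>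
    rcases h with ⟨rfl, h⟩ | h
    · simp [h]
    · simp [ih h]

lemma Bef_append (l l' : List ℕ) (x y : ℕ) :
    Bef (l ++ l') x y ↔ Bef l x y ∨ (x ∈ l ∧ y ∈ l') ∨ Bef l' x y := by
  induction l with
  | nil => simp [Bef]
  | cons a l ih =>
    simp only [List.cons_append, Bef, ih, List.mem_append, List.mem_cons]
    tauto

lemma Bef_split (L R : List ℕ) (m x y : ℕ) :
    Bef (L ++ m :: R) x y ↔ Bef L x y ∨ (x ∈ L ∧ (y = m ∨ y ∈ R)) ∨ (x = m ∧ y ∈ R) ∨ Bef R x y := by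
  rw [Bef_append, List.mem_cons]; rfl

lemma Bef_ofFn {n : ℕ} (f : Fin n → ℕ) (x y : ℕ) :
    Bef (List.ofFn f) x y ↔ ∃ i j : Fin n, i < j ∧ f i = x ∧ f j = y := by
  induction n with
  | zero => simp [Bef]
  | succ n ih =>
    rw [List.ofFn_succ, Bef, ih]
    simp only [Fin.exists_fin_succ, List.mem_ofFn, Set.mem_range]
    simp [eq_comm]

def UR (l : List ℕ) (x : ℕ) : Prop := ∃ y, x < y ∧ Bef l x y
def UL (l : List ℕ) (x : ℕ) : Prop := ∃ y, x < y ∧ Bef l y x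
def DL (l : List ℕ) (x : ℕ) : Prop := ∃ y, y < x ∧ Bef l y x
def DR (l : List ℕ) (x : ℕ) : Prop := ∃ y, y < x ∧ Bef l x y

/-- Data for a decomposition at the maximum. -/
structure Spl (L : List ℕ) (m : ℕ) (R : List ℕ) : Prop where
  hL : ∀ x ∈ L, x < m
  hR : ∀ x ∈ R, x < m
  hLR : ∀ x ∈ L, ∀ y ∈ R, y < x

section
variable {L R : List ℕ} {m x : ℕ} (S : Spl L m R)

lemma Spl.notR (S : Spl L m R) (hx : x ∈ L) : x ≠ m ∧ x ∉ R :=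
  ⟨(S.hL x hx).ne, fun h => lt_irrefl _ (S.hLR x hx x h)⟩

lemma Spl.notL (S : Spl L m R) (hx : x ∈ R) : x ≠ m ∧ x ∉ L :=
  ⟨(S.hR x hx).ne, fun h => lt_irrefl _ (S.hLR x h x hx)⟩

lemma Spl.notm (S : Spl L m R) : m ∉ L ∧ m ∉ R :=
  ⟨fun h => lt_irrefl _ (S.hL m h), fun h => lt_irrefl _ (S.hR m h)⟩

lemma UR_L (S : Spl L m R) (hx : x ∈ L) : UR (L ++ m :: R) x ↔ True := by
  simp only [UR, Bef_split, iff_true]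
  exact ⟨m, S.hL x hx, by simp [hx]⟩

lemma UL_L (S : Spl L m R) (hx : x ∈ L) : UL (L ++ m :: R) x ↔ UL L x := by
  have := S.notR hx
  have h (y) : ¬ Bef R y x := fun h => this.2 h.mem.2
  simp [UL, Bef_split, this, h]

lemma DL_L (S : Spl L m R) (hx : x ∈ L) : DL (L ++ m :: R) x ↔ DL L x := by
  have := S.notR hx
  have h (y) : ¬ Bef R y x := fun h => this.2 h.mem.2
  simp [DL, Bef_split, this, h]

lemma DR_L (S : Spl L m R) (hx : x ∈ L) : DR (L ++ m :: R) x ↔ (R ≠ [] ∨ DR L x) := by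
  have := S.notR hx
  have h (y) : ¬ Bef R x y := fun h => this.2 h.mem.1
  simp only [DR, Bef_split, this, h, hx]
  constructor
  · rintro ⟨y, hy, h | h | h⟩
    · exact Or.inr ⟨y, hy, h⟩
    · rcases h.2 with rfl | h
      · exact absurd (S.hL x hx) (by omega)
      · exact Or.inl (List.ne_nil_of_mem h)
    · simp at h
  · rintro (h | ⟨y, hy, h⟩)
    · obtain ⟨y, hy⟩ := List.exists_mem_of_ne_nil _ h
      exact ⟨y, S.hLR x hx y hy, by simp [hy]⟩
    · exact ⟨y, hy, by simp [h]⟩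

lemma UR_R (S : Spl L m R) (hx : x ∈ R) : UR (L ++ m :: R) x ↔ UR R x := by
  have := S.notL hx
  have h (y) : ¬ Bef L x y := fun h => this.2 h.mem.1
  simp [UR, Bef_split, this, h]

lemma UL_R (S : Spl L m R) (hx : x ∈ R) : UL (L ++ m :: R) x ↔ True := by
  simp only [UL, Bef_split, iff_true]
  exact ⟨m, S.hR x hx, by simp [hx]⟩

lemma DL_R (S : Spl L m R) (hx : x ∈ R) : DL (L ++ m :: R) x ↔ DL R x := by
  have := S.notL hx
  have h (y) : ¬ Bef L y x := fun h => this.2 h.mem.2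
  simp only [DL, Bef_split, this, h, hx]
  constructor
  · rintro ⟨y, hy, h | h | h | h⟩
    · exact h.elim
    · exact absurd (S.hLR y h.1 x hx) (by omega)
    · exact absurd (S.hR x hx) (by omega)
    · exact ⟨y, hy, h⟩
  · rintro ⟨y, hy, h⟩
    exact ⟨y, hy, by simp [h]⟩

lemma DR_R (S : Spl L m R) (hx : x ∈ R) : DR (L ++ m :: R) x ↔ DR R x := by
  have := S.notL hx
  have h (y) : ¬ Bef L x y := fun h => this.2 h.mem.1
  simp [DR, Bef_split, this, h]

lemma UR_m (S : Spl L m R) : UR (L ++ m :: R) m ↔ False := by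
  simp only [UR, iff_false]
  rintro ⟨y, hy, h⟩
  have := h.mem.2
  simp only [List.mem_append, List.mem_cons] at this
  rcases this with h | h | h
  · exact absurd (S.hL y h) (by omega)
  · omega
  · exact absurd (S.hR y h) (by omega)

lemma UL_m (S : Spl L m R) : UL (L ++ m :: R) m ↔ False := by
  simp only [UL, iff_false]
  rintro ⟨y, hy, h⟩
  have := h.mem.1
  simp only [List.mem_append, List.mem_cons] at this
  rcases this with h | h | h
  · exact absurd (S.hL y h) (by omega)
  · omega
  · exact absurd (S.hR y h) (by omega)

lemma DL_m (S : Spl L m R) : DL (L ++ m :: R) m ↔ L ≠ [] := by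
  have h1 (y) : ¬ Bef L y m := fun h => S.notm.1 h.mem.2
  have h2 (y) : ¬ Bef R y m := fun h => S.notm.2 h.mem.2
  simp only [DL, Bef_split, h1, h2, S.notm]
  constructor
  · rintro ⟨y, hy, h⟩
    simp at h
    exact List.ne_nil_of_mem h
  · intro h
    obtain ⟨y, hy⟩ := List.exists_mem_of_ne_nil _ h
    exact ⟨y, S.hL y hy, by simp [hy]⟩

lemma DR_m (S : Spl L m R) : DR (L ++ m :: R) m ↔ R ≠ [] := by
  have h1 (y) : ¬ Bef L m y := fun h => S.notm.1 h.mem.1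
  have h2 (y) : ¬ Bef R m y := fun h => S.notm.2 h.mem.1
  simp only [DR, Bef_split, h1, h2, S.notm]
  constructor
  · rintro ⟨y, hy, h⟩
    simp at h
    exact List.ne_nil_of_mem h
  · intro h
    obtain ⟨y, hy⟩ := List.exists_mem_of_ne_nil _ h
    exact ⟨y, S.hR y hy, by simp [hy]⟩

end

/-- Number of elements of `l` not satisfying the pattern with the given flags. -/
noncomputable def df (a b c d : Prop) (l : List ℕ) : ℕ :=
  open Classical in
  l.countP (fun x => decide (¬ ((a → UR l x) ∧ (b → UL l x) ∧ (c → DL l x) ∧ (d → DR l x))))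

lemma df_split {L R : List ℕ} {m : ℕ} (S : Spl L m R) (a b c d : Prop) :
    df a b c d (L ++ m :: R) = df False b c (d ∧ R = []) L +
      (open Classical in if a ∨ b ∨ (c ∧ L = []) ∨ (d ∧ R = []) then 1 else 0)
      + df a False c d R := by
  classical
  unfold df
  rw [List.countP_append, List.countP_cons]
  have e1 : ∀ p q r s : ℕ, p = q → r = s → ∀ t u : ℕ, t = u → p + (r + t) = q + u + s := by
    intros; omega
  apply e1
  · apply List.countP_congr
    intro x hx
    simp only [UR_L S hx, UL_L S hx, DL_L S hx, DR_L S hx, decide_eq_true_eq]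
    tauto
  · apply List.countP_congr
    intro x hx
    simp only [UR_R S hx, UL_R S hx, DL_R S hx, DR_R S hx, decide_eq_true_eq]
    tauto
  · simp only [UR_m S, UL_m S, DL_m S, DR_m S, decide_eq_true_eq]
    congr 1
    apply propext
    tauto

def Avd (l : List ℕ) : Prop := ∀ x y z, Bef l x z → Bef l z y → x < y → y < z → False

structure Valid (s n : ℕ) (l : List ℕ) : Prop where
  nd : l.Nodup
  mem : ∀ x, x ∈ l ↔ s ≤ x ∧ x < s + n
  av : Avd l

lemma Valid.length {s n : ℕ} {l : List ℕ} (h : Valid s n l) : l.length = n := by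
  rw [← List.toFinset_card_of_nodup h.nd, show l.toFinset = Finset.Ico s (s + n) by
    ext x; simp [h.mem]]
  simp

def toL : ℕ → BinaryTree Unit → List ℕ
  | _, .nil => []
  | s, .node _ L R => toL (s + R.numNodes) L ++ (s + L.numNodes + R.numNodes) :: toL s R

lemma toL_mem (t : BinaryTree Unit) : ∀ s x, x ∈ toL s t ↔ s ≤ x ∧ x < s + t.numNodes := by
  induction t with
  | nil => intro s x; simp [toL, BinaryTree.numNodes]
  | node _ L R ihL ihR =>
    intro s x
    simp only [toL, List.mem_append, List.mem_cons, ihL, ihR, BinaryTree.numNodes]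
    omega

lemma toL_spl (s : ℕ) (L R : BinaryTree Unit) :
    Spl (toL (s + R.numNodes) L) (s + L.numNodes + R.numNodes) (toL s R) := by
  constructor
  · intro x hx; rw [toL_mem] at hx; omega
  · intro x hx; rw [toL_mem] at hx; omega
  · intro x hx y hy; rw [toL_mem] at hx hy; omega

lemma avd_split {L R : List ℕ} {m : ℕ} (S : Spl L m R) (hL : Avd L) (hR : Avd R) :
    Avd (L ++ m :: R) := by
  intro x y z h1 h2 h3 h4
  rw [Bef_split] at h1 h2
  have nm := S.notm
  rcases h1 with h1 | ⟨h1, h1'⟩ | ⟨h1, h1'⟩ | h1 <;> rcases h2 with h2 | ⟨h2, h2'⟩ | ⟨h2, h2'⟩ | h2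
  · exact hL x y z h1 h2 h3 h4
  · have := S.hL z h2
    rcases h2' with rfl | h2'
    · omega
    · have := S.hLR x h1.mem.1 y h2'; omega
  · subst h2; exact nm.1 h1.mem.2
  · exact (S.notR h1.mem.2).2 h2.mem.1
  · have := S.notR h2.mem.1
    tauto
  · have := S.notR h2
    tauto
  · have := S.hLR x h1 y h2'; omega
  · have := S.hLR x h1 y h2.mem.2; omega
  · exact (S.notR h2.mem.1).2 h1'
  · exact (S.notR h2).2 h1'
  · have := S.hR z h1'; omega
  · have := S.hR z h1'; have := S.hR y h2.mem.2; omega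
  · exact (S.notR h2.mem.1).2 h1.mem.2
  · exact (S.notR h2).2 h1.mem.2
  · subst h2; exact nm.2 h1.mem.2
  · exact hR x y z h1 h2 h3 h4

lemma toL_valid (t : BinaryTree Unit) : ∀ s, Valid s t.numNodes (toL s t) := by
  induction t with
  | nil => intro s; exact ⟨by simp [toL], toL_mem _ _, fun x y z h => by simp [toL, Bef] at h⟩
  | node _ L R ihL ihR =>
    intro s
    have S := toL_spl s L R
    refine ⟨?_, toL_mem _ _, avd_split S (ihL _).av (ihR _).av⟩
    rw [toL, List.nodup_append]
    refine ⟨(ihL _).nd, List.nodup_cons.2 ⟨S.notm.2, (ihR _).nd⟩, ?_⟩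
    intro x hx y hy e
    subst e
    have := S.notR hx
    simp only [List.mem_cons] at hy
    tauto

lemma split_unique {L R L' R' : List ℕ} {m : ℕ} (h : L ++ m :: R = L' ++ m :: R')
    (h1 : m ∉ L) (h2 : m ∉ L') : L = L' ∧ R = R' := by
  induction L generalizing L' with
  | nil =>
    cases L' with
    | nil => simpa using h
    | cons a L' => simp at h h2; tauto
  | cons b L ih =>
    cases L' with
    | nil => simp at h h1; tauto
    | cons a L' =>
      simp only [List.cons_append, List.cons.injEq, List.mem_cons, not_or] at *
      have := ih h.2 h1.2 h2.2
      exact ⟨⟨h.1, this.1⟩, this.2⟩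

lemma toL_inj (t : BinaryTree Unit) : ∀ t' s, toL s t = toL s t' → t = t' := by
  induction t with
  | nil =>
    intro t' s h
    cases t' with
    | nil => rfl
    | node _ L R => simp [toL] at h
  | node _ L R ihL ihR =>
    intro t' s h
    cases t' with
    | nil => simp [toL] at h
    | node _ L' R' =>
      have hl := congrArg List.length h
      rw [(toL_valid _ _).length, (toL_valid _ _).length] at hl
      simp only [BinaryTree.numNodes] at hl
      simp only [toL] at h
      have S := toL_spl s L R
      have S' := toL_spl s L' R'
      rw [show s + L'.numNodes + R'.numNodes = s + L.numNodes + R.numNodes by omega] at h S'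
      obtain ⟨h1, h2⟩ := split_unique h S.notm.1 S'.notm.1
      have e := ihR _ _ h2
      subst e
      rw [ihL _ _ h1]

lemma down_closed (S : Finset ℕ) (s : ℕ) (h : ∀ y ∈ S, s ≤ y ∧ ∀ x, s ≤ x → x < y → x ∈ S) :
    S = Finset.Ico s (s + S.card) := by
  apply Finset.eq_of_subset_of_card_le
  · intro y hy
    have h2 : Finset.Ico s (y + 1) ⊆ S := by
      intro x hx
      rw [Finset.mem_Ico] at hx
      rcases eq_or_ne x y with rfl | hne
      · exact hy
      · exact (h y hy).2 x hx.1 (by omega)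
    have := Finset.card_le_card h2
    have := (h y hy).1
    rw [Nat.card_Ico] at *
    rw [Finset.mem_Ico]; omega
  · simp

lemma toL_surj (n : ℕ) : ∀ s l, Valid s n l → ∃ t : BinaryTree Unit, t.numNodes = n ∧ toL s t = l := by
  induction n using Nat.strong_induction_on with
  | _ n ih =>
    intro s l h
    rcases n with _ | n
    · have := h.length
      exact ⟨.nil, rfl, by rw [List.length_eq_zero_iff.1 this]; rfl⟩
    have hm : s + n ∈ l := by rw [h.mem]; omega
    obtain ⟨L, R, rfl⟩ := List.append_of_mem hm
    have nd := h.nd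
    rw [List.nodup_append, List.nodup_cons] at nd
    obtain ⟨ndL, ⟨mR, ndR⟩, dis⟩ := nd
    have mem : ∀ x, (x ∈ L ∨ x = s + n ∨ x ∈ R) ↔ s ≤ x ∧ x < s + (n + 1) := by
      intro x; rw [← h.mem]; simp
    have mL : s + n ∉ L := fun h => dis _ h _ (by simp) rfl
    have hlen := h.length
    simp only [List.length_append, List.length_cons] at hlen
    have hR : ∀ x, x ∈ R ↔ s ≤ x ∧ x < s + R.length := by
      have := down_closed R.toFinset s (by
        intro y hy
        rw [List.mem_toFinset] at hy
        have hy' := (mem y).1 (by tauto)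
        refine ⟨hy'.1, fun x h1 h2 => ?_⟩
        have hyn : y ≠ s + n := by rintro rfl; exact mR hy
        rcases (mem x).2 (by omega) with hx | hx | hx
        · exact (h.av x y (s + n) (by rw [Bef_split]; simp [hx]) (by rw [Bef_split]; simp [hy]) h2
            (by omega)).elim
        · omega
        · simpa using hx)
      rw [List.toFinset_card_of_nodup ndR] at this
      intro x
      rw [← List.mem_toFinset, this, Finset.mem_Ico]
    have hL : ∀ x, x ∈ L ↔ s + R.length ≤ x ∧ x < s + R.length + L.length := by
      intro x
      have h1 := mem x
      have h2 := hR x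
      constructor
      · intro hx
        have : x ≠ s + n := by rintro rfl; exact mL hx
        have : x ∉ R := fun h => dis _ hx _ (by simp [h]) rfl
        have := h1.1 (Or.inl hx)
        by_contra hc
        exact ‹x ∉ R› (h2.2 (by omega))
      · intro hx
        rcases h1.2 (by omega) with h | h | h
        · exact h
        · omega
        · have := h2.1 h; omega
    obtain ⟨tL, nL, eL⟩ := ih L.length (by omega) (s + R.length) L
      ⟨ndL, hL, fun x y z a b => h.av x y z (by rw [Bef_split]; tauto) (by rw [Bef_split]; tauto)⟩
    obtain ⟨tR, nR, eR⟩ := ih R.length (by omega) s R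
      ⟨ndR, hR, fun x y z a b => h.av x y z (by rw [Bef_split]; tauto) (by rw [Bef_split]; tauto)⟩
    refine ⟨.node () tL tR, by simp [BinaryTree.numNodes, nL, nR]; omega, ?_⟩
    rw [toL, nR, nL, eL, eR, show s + L.length + R.length = s + n by omega]

lemma toL_nil (s : ℕ) (t : BinaryTree Unit) : toL s t = [] ↔ t = .nil := by
  cases t <;> simp [toL]

lemma dfA (t : BinaryTree Unit) : ∀ s, df False False True False (toL s t) = dA t := by
  induction t with
  | nil => intro s; simp [toL, df, dA]
  | node _ L R ihL ihR =>
    intro s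
    rw [toL, df_split (toL_spl s L R)]
    simp [ihL, ihR, dA, toL_nil]

lemma dfB (t : BinaryTree Unit) : ∀ s, df False True True False (toL s t) = dB t := by
  induction t with
  | nil => intro s; simp [toL, df, dB]
  | node _ L R ihL ihR =>
    intro s
    rw [toL, df_split (toL_spl s L R)]
    simp [ihL, dfA, dB]

lemma dfE (t : BinaryTree Unit) : ∀ s, df False False True True (toL s t) = dE t := by
  induction t with
  | nil => intro s; simp [toL, df, dE]
  | node _ L R ihL ihR =>
    intro s
    rw [toL, df_split (toL_spl s L R)]
    by_cases h : R = .nil <;> simp [ihL, ihR, dfA, dE, toL_nil, h]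
    simp [toL, df]

lemma dfF (t : BinaryTree Unit) : ∀ s, df True False True True (toL s t) = dF t := by
  induction t with
  | nil => intro s; simp [toL, df, dF]
  | node _ L R ihL ihR =>
    intro s
    rw [toL, df_split (toL_spl s L R)]
    by_cases h : R = .nil <;> simp [ihR, dfA, dfE, dF, toL_nil, h]
    simp [toL, df]

lemma dfG (t : BinaryTree Unit) : ∀ s, df False True True True (toL s t) = dG t := by
  induction t with
  | nil => intro s; simp [toL, df, dG]
  | node _ L R ihL ihR =>
    intro s
    rw [toL, df_split (toL_spl s L R)]
    by_cases h : R = .nil <;> simp [ihL, dfB, dfE, dG, toL_nil, h]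

lemma dfH (t : BinaryTree Unit) (s : ℕ) : df True True True True (toL s t) = dH t := by
  cases t with
  | nil => simp [toL, df, dH]
  | node _ L R =>
    rw [toL, df_split (toL_spl s L R)]
    by_cases h : R = .nil <;> simp [dfG, dfB, dfF, dH, toL_nil, h]

/-- The one-line word of a permutation. -/
def word {n : ℕ} (σ : Equiv.Perm (Fin n)) : List ℕ := List.ofFn (fun i => (σ i : ℕ))

lemma word_inj {n : ℕ} : Function.Injective (word (n := n)) := by
  intro σ τ h
  have := List.ofFn_injective h
  ext i
  exact congrFun this i

lemma word_bef {n : ℕ} (σ : Equiv.Perm (Fin n)) (i j : Fin n) :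
    Bef (word σ) (σ i) (σ j) ↔ i < j := by
  rw [word, Bef_ofFn]
  simp only [Fin.val_inj, σ.injective.eq_iff]
  simp

lemma word_mem {n : ℕ} (σ : Equiv.Perm (Fin n)) (x : ℕ) : x ∈ word σ ↔ x < n := by
  rw [word, List.mem_ofFn]
  constructor
  · rintro ⟨i, rfl⟩; exact (σ i).2
  · intro h; exact ⟨σ.symm ⟨x, h⟩, by simp⟩

lemma word_av {n : ℕ} (σ : Equiv.Perm (Fin n)) : Avd (word σ) ↔ Avoids132 σ := by
  constructor
  · rintro h ⟨i, j, k, h1, h2, h3, h4⟩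
    exact h (σ i) (σ k) (σ j) ((word_bef σ i j).2 h1) ((word_bef σ j k).2 h2) h3 h4
  · intro h x y z h1 h2 h3 h4
    obtain ⟨i, hi⟩ := List.mem_ofFn.1 h1.mem.1
    obtain ⟨j, hj⟩ := List.mem_ofFn.1 h1.mem.2
    obtain ⟨k, hk⟩ := List.mem_ofFn.1 h2.mem.2
    subst hi hj hk
    rw [word_bef] at h1 h2
    exact h ⟨i, j, k, h1, h2, h3, h4⟩

lemma word_valid {n : ℕ} (σ : Equiv.Perm (Fin n)) : Valid 0 n (word σ) ↔ Avoids132 σ := by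
  rw [← word_av]
  refine ⟨fun h => h.av, fun h => ⟨?_, ?_, h⟩⟩
  · rw [word, List.nodup_ofFn]
    exact fun i j h => σ.injective (Fin.ext h)
  · intro x; simp [word_mem]

lemma word_surj {n : ℕ} {l : List ℕ} (h : Valid 0 n l) : ∃ σ : Equiv.Perm (Fin n), word σ = l := by
  obtain rfl := h.length
  let f : Fin l.length → Fin l.length := fun i => ⟨l.get i, by
    have := (h.mem (l.get i)).1 (List.get_mem _ _); omega⟩
  have hf : Function.Injective f := by
    intro i j hij
    exact (List.nodup_iff_injective_get.1 h.nd) (by simpa [f] using hij)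
  refine ⟨Equiv.ofBijective f (Finite.injective_iff_bijective.1 hf), ?_⟩
  simp [word, f]

lemma exists_word {n : ℕ} (σ : Equiv.Perm (Fin n)) (p : ℕ → Prop) (hp : ∀ x, p x → x ∈ word σ) :
    (∃ x, p x) ↔ ∃ j, p (σ j) := by
  constructor
  · rintro ⟨x, hx⟩
    obtain ⟨i, hi⟩ := List.mem_ofFn.1 (hp x hx)
    exact ⟨i, by simpa [hi] using hx⟩
  · rintro ⟨j, hj⟩; exact ⟨_, hj⟩

lemma matches_iff {n : ℕ} (σ : Equiv.Perm (Fin n)) (i : Fin n) :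
    MatchesMMP 1 1 1 1 σ i ↔ UR (word σ) (σ i) ∧ UL (word σ) (σ i) ∧ DL (word σ) (σ i) ∧
      DR (word σ) (σ i) := by
  unfold MatchesMMP UR UL DL DR
  rw [exists_word σ _ (fun x hx => hx.2.mem.2), exists_word σ _ (fun x hx => hx.2.mem.1),
    exists_word σ _ (fun x hx => hx.2.mem.1), exists_word σ _ (fun x hx => hx.2.mem.2)]
  simp only [word_bef, Nat.one_le_iff_ne_zero, ne_eq, Finset.card_eq_zero,
    ← Finset.nonempty_iff_ne_empty, Finset.filter_nonempty_iff, Finset.mem_univ, true_and,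
    Fin.val_fin_lt, and_comm]

lemma countP_ofFn' {n : ℕ} (f : Fin n → ℕ) (p : ℕ → Bool) :
    (List.ofFn f).countP p = (Finset.univ.filter (fun i => p (f i) = true)).card := by
  induction n with
  | zero => simp
  | succ n ih =>
    rw [List.ofFn_succ, List.countP_cons, ih, Fin.card_filter_univ_succ]
    split_ifs <;> simp

lemma df_word {n : ℕ} (σ : Equiv.Perm (Fin n)) :
    mmp 1 1 1 1 σ + df True True True True (word σ) = n := by
  classical
  have h : df True True True True (word σ) =
      (Finset.univ.filter (fun i => ¬ MatchesMMP 1 1 1 1 σ i)).card := by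
    unfold df
    conv_lhs => rw [word, countP_ofFn']
    congr 1
    ext i
    rw [Finset.mem_filter, Finset.mem_filter, matches_iff]
    simp [word]
    tauto
  rw [h, mmp, Finset.card_filter_add_card_filter_not]
  simp

lemma image_eq (n : ℕ) :
    (Av132 n).image word = (BinaryTree.treesOfNumNodesEq n).image (toL 0) := by
  ext l
  simp only [Finset.mem_image, Av132, Finset.mem_filter, Finset.mem_univ, true_and,
    BinaryTree.mem_treesOfNumNodesEq]
  constructor
  · rintro ⟨σ, hσ, rfl⟩
    exact toL_surj n 0 _ ((word_valid σ).2 hσ)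
  · rintro ⟨t, rfl, rfl⟩
    obtain ⟨σ, hσ⟩ := word_surj (toL_valid t 0)
    exact ⟨σ, (word_valid σ).1 (hσ ▸ toL_valid t 0), hσ⟩

lemma count_eq (n : ℕ) (hn : 6 ≤ n) : #{σ ∈ Av132 n | mmp 1 1 1 1 σ = n - 5} =
    #{t ∈ BinaryTree.treesOfNumNodesEq n | dH t = 5} := by
  have h1 : #{l ∈ (Av132 n).image word | df True True True True l = 5} =
      #{σ ∈ Av132 n | mmp 1 1 1 1 σ = n - 5} := by
    rw [Finset.filter_image, Finset.card_image_of_injective _ word_inj]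
    congr 1
    apply Finset.filter_congr
    intro σ _
    have := df_word σ
    omega
  have h2 : #{l ∈ (BinaryTree.treesOfNumNodesEq n).image (toL 0) | df True True True True l = 5} =
      #{t ∈ BinaryTree.treesOfNumNodesEq n | dH t = 5} := by
    rw [Finset.filter_image, Finset.card_image_of_injective _ (fun t t' h => toL_inj t t' 0 h)]
    simp only [dfH]
  rw [← h1, ← h2, image_eq]

end Lists

/-- for `n ≥ 6`, the coefficient of `x^{n-5}` in
`Q_{n,132}^{(1,1,1,1)}(x)` equals `17 + 4·binom(n-3,2)`. -/
theorem stmt19 (n : ℕ) (hn : 6 ≤ n) :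
    (Q n 1 1 1 1).coeff (n - 5) = ((17 + 4 * (n - 3).choose 2 : ℕ) : ℤ) := by
  rw [← H5_coeff n hn, gf_coeff, ← count_eq n hn]
  simp [Q, Polynomial.coeff_X_pow, eq_comm]
end
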